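/- For n = 3 (the full flag manifold SU(4)/T³), the set of Einstein solutions λ = (λ_{ij})_{1 ≤ i < j ≤ 4} normalized by λ₁₂ = 1 is finite; that is, SU(4)/T³ admits only finitely many invariant Einstein metrics up to scaling. -/

import Mathlib

open Finset

/-- Pairs `i < j` in `{1, …, n+1}` (modeled as `Fin (n+1)`), indexing the
positive roots / isotropy summands of the full flag manifold `SU(n+1)/Tⁿ`. -/
abbrev FlagIdx (n : ℕ) := {p : Fin (n + 1) × Fin (n + 1) // p.1 < p.2}

/-- Symmetric extension `λ_{ji} := λ_{ij}` of a family indexed by pairs `i < j`.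
(The diagonal value is irrelevant; we set it to `1`.) -/
def symExt (n : ℕ) (lam : FlagIdx n → ℝ) (i j : Fin (n + 1)) : ℝ :=
  if h : i < j then lam ⟨(i, j), h⟩
  else if h : j < i then lam ⟨(j, i), h⟩
  else 1

/-- Sakane's formula for the component `r_{ij}` of the Ricci tensor of the
invariant metric determined by `lam` on `SU(n+1)/Tⁿ`. -/
noncomputable def ricci (n : ℕ) (lam : FlagIdx n → ℝ) (i j : Fin (n + 1)) : ℝ :=
  1 / (2 * symExt n lam i j) + (1 / (4 * ((n : ℝ) + 1))) *
    ∑ k ∈ univ.filter (fun k : Fin (n + 1) => k ≠ i ∧ k ≠ j),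
      (symExt n lam i j / (symExt n lam i k * symExt n lam k j)
        - symExt n lam i k / (symExt n lam i j * symExt n lam k j)
        - symExt n lam j k / (symExt n lam i j * symExt n lam i k))

/-- `lam` is an Einstein solution with Einstein constant `k`:
`r_{ij}(lam) = k` for all `1 ≤ i < j ≤ n+1`. -/
def IsEinstein (n : ℕ) (lam : FlagIdx n → ℝ) (k : ℝ) : Prop :=
  ∀ i j : Fin (n + 1), i < j → ricci n lam i j = k

/-- Scalar curvature `S(λ) = 2 Σ_{i<j} r_{ij}(λ)`. -/
noncomputable def scalarCurv (n : ℕ) (lam : FlagIdx n → ℝ) : ℝ :=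
  2 * ∑ p : FlagIdx n, ricci n lam p.1.1 p.1.2

/-- Volume `V(λ) = Π_{i<j} λ_{ij}²`. -/
noncomputable def vol (n : ℕ) (lam : FlagIdx n → ℝ) : ℝ :=
  ∏ p : FlagIdx n, (lam p) ^ 2

/-- Scale invariant `H(λ) = V(λ)^{1/d} · S(λ)`, where `d = n(n+1)`. -/
noncomputable def scaleInv (n : ℕ) (lam : FlagIdx n → ℝ) : ℝ :=
  vol n lam ^ ((1 : ℝ) / ((n : ℝ) * ((n : ℝ) + 1))) * scalarCurv n lam

/-- The Kähler–Einstein tuple `λ_{ij} = |σ(i) − σ(j)|` associated to a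
permutation `σ` (i.e. to an order of the root system). -/
noncomputable def kahlerFam (n : ℕ) (σ : Equiv.Perm (Fin (n + 1))) : FlagIdx n → ℝ :=
  fun p => |((σ p.1.1 : ℕ) : ℝ) - ((σ p.1.2 : ℕ) : ℝ)|

/-- The family `λ_{ij} = n/(n+2)` if `t ∈ {i, j}`, and `λ_{ij} = 1` otherwise. -/
noncomputable def tFam (n : ℕ) (t : Fin (n + 1)) : FlagIdx n → ℝ :=
  fun p => if p.1.1 = t ∨ p.1.2 = t then (n : ℝ) / ((n : ℝ) + 2) else 1

/-- Two families are proportional if one is a positive scalar multiple of the other. -/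
def Proportional (n : ℕ) (f g : FlagIdx n → ℝ) : Prop :=
  ∃ c : ℝ, 0 < c ∧ ∀ p, f p = c * g p

theorem exists_ringHom_lift_of_formallySmooth {E L B : Type*} [CommRing E] [CommRing L] [CommRing B]
    [Algebra E L] [Algebra.FormallySmooth E L] (φ : E →+* B) (π : B →+* L)
    (hπ : Function.Surjective π) (hker : IsNilpotent (RingHom.ker π))
    (h : π.comp φ = algebraMap E L) :
    ∃ ψ : L →+* B, ψ.comp (algebraMap E L) = φ ∧ π.comp ψ = RingHom.id L := by
  let := φ.toAlgebra
  let π' : B →ₐ[E] L := { π with commutes' := fun r => DFunLike.congr_fun h r }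
  have hπ' : Function.Surjective π' := hπ
  have hk : IsNilpotent (RingHom.ker (π' : B →+* L)) := hker
  refine ⟨(Algebra.FormallySmooth.liftOfSurjective (AlgHom.id E L) π' hπ' hk : L →ₐ[E] B), ?_, ?_⟩
  · ext r
    exact (Algebra.FormallySmooth.liftOfSurjective (AlgHom.id E L) π' hπ' hk).commutes r
  · ext r
    exact Algebra.FormallySmooth.liftOfSurjective_apply (AlgHom.id E L) π' hπ' hk r

theorem formallySmooth_of_charZero (E L : Type*) [Field E] [Field L] [Algebra E L] [CharZero E] :
    Algebra.FormallySmooth E L := by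
  obtain ⟨s, hs⟩ := exists_isTranscendenceBasis E L
  have : Algebra.IsAlgebraic (IntermediateField.adjoin E (Set.range ((↑) : s → L))) L :=
    hs.isAlgebraic_field
  exact .of_algebraicIndependent_of_isSeparable hs.1

theorem exists_derivation_ne_zero {K L : Type*} [Field K] [Field L] [Algebra K L] [CharZero K]
    {c : L} (hc : Transcendental K c) : ∃ D : Derivation ℤ L L, D c ≠ 0 := by
  let : Algebra (Polynomial K) L := (Polynomial.aeval c).toAlgebra
  have hX : algebraMap (Polynomial K) L Polynomial.X = c := Polynomial.aeval_X c
  have hinj : Function.Injective (algebraMap (Polynomial K) L) :=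
    transcendental_iff_injective.mp hc
  have : FaithfulSMul (Polynomial K) L := (faithfulSMul_iff_algebraMap_injective _ _).mpr hinj
  let : Algebra (FractionRing (Polynomial K)) L := FractionRing.liftAlgebra (Polynomial K) L
  have := FractionRing.isScalarTower_liftAlgebra (Polynomial K) L
  have : CharZero (FractionRing (Polynomial K)) :=
    charZero_of_injective_algebraMap (IsFractionRing.injective (Polynomial K) _)
  have := formallySmooth_of_charZero (FractionRing (Polynomial K)) L
  let f : Polynomial K →+* TrivSqZeroExt L L :=
    (Polynomial.aeval (TrivSqZeroExt.inl c + TrivSqZeroExt.inr 1 : TrivSqZeroExt L L)).toRingHom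
  let π : TrivSqZeroExt L L →+* L := (TrivSqZeroExt.fstHom K L L).toRingHom
  have hfπ : π.comp f = algebraMap (Polynomial K) L := by
    have : (TrivSqZeroExt.fstHom K L L).comp
      (Polynomial.aeval (TrivSqZeroExt.inl c + TrivSqZeroExt.inr 1 : TrivSqZeroExt L L)) =
        Polynomial.aeval c := by
      ext; simp
    exact congrArg (fun g : Polynomial K →ₐ[K] L => (g : Polynomial K →+* L)) this
  have hunit : ∀ y : nonZeroDivisors (Polynomial K), IsUnit (f y) := by
    intro y
    rw [TrivSqZeroExt.isUnit_iff_isUnit_fst, isUnit_iff_ne_zero]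
    change π.comp f y ≠ 0
    rw [hfπ]
    exact (map_ne_zero_iff _ hinj).mpr (nonZeroDivisors.ne_zero y.2)
  let φ : FractionRing (Polynomial K) →+* TrivSqZeroExt L L := IsLocalization.lift hunit
  have hφπ : π.comp φ = algebraMap _ L := by
    apply IsLocalization.ringHom_ext (nonZeroDivisors (Polynomial K))
    rw [RingHom.comp_assoc, IsLocalization.lift_comp, hfπ, ← IsScalarTower.algebraMap_eq]
  obtain ⟨ψ, h1, h2⟩ := exists_ringHom_lift_of_formallySmooth φ π
    TrivSqZeroExt.fst_surjective
    ⟨2, by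
      rw [pow_two, Ideal.zero_eq_bot, eq_bot_iff, Ideal.mul_le]
      intro r hr s hs
      have hr' : r.fst = 0 := hr
      have hs' : s.fst = 0 := hs
      rw [Ideal.mem_bot]
      ext <;> simp [hr', hs']⟩ hφπ
  have hfst : ∀ x, (ψ x).fst = x := fun x => DFunLike.congr_fun h2 x
  refine ⟨Derivation.mk' ((TrivSqZeroExt.sndHom L L).toAddMonoidHom.comp
    ψ.toAddMonoidHom).toIntLinearMap ?_, ?_⟩
  · intro a b
    simp [hfst]
    ring
  · have h3 : ψ (algebraMap (Polynomial K) L Polynomial.X) =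
        TrivSqZeroExt.inl c + TrivSqZeroExt.inr 1 := by
      rw [IsScalarTower.algebraMap_apply (Polynomial K) (FractionRing (Polynomial K)) L,
        ← RingHom.comp_apply, h1]
      simp [φ, f]
    rw [hX] at h3
    simp [h3]

theorem exists_valuationSubring {K L : Type*} [Field K] [Field L] [Algebra K L] {t : L}
    (ht : Transcendental K t) :
    ∃ V : ValuationSubring L, (∀ a : K, algebraMap K L a ∈ V) ∧ t ∉ V := by
  by_contra! hV
  let s : Set L := Set.range (algebraMap K L)
  have hmem : t ∈ (⨅ V : {V : ValuationSubring L // s ⊆ V.toSubring}, V.1.toSubring) := by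
    rw [Subring.mem_iInf]
    exact fun V => hV V.1 fun a => V.2 ⟨a, rfl⟩
  rw [iInf_valuationSubring_superset] at hmem
  have h_integral : IsIntegral (Subring.closure s) t := hmem
  let e : K ≃+* (algebraMap K L).range :=
    RingEquiv.ofBijective (algebraMap K L).rangeRestrict
      ⟨fun a b h => (algebraMap K L).injective (congrArg Subtype.val h),
        (algebraMap K L).rangeRestrict_surjective⟩
  have hle : Subring.closure s ≤ (algebraMap K L).range := Subring.closure_le.2 fun _ h => h
  have := h_integral.map_of_comp_eq ((e.symm : _ →+* K).comp (Subring.inclusion hle))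
    (RingHom.id L) (by
    ext a
    exact congrArg Subtype.val (e.apply_symm_apply (Subring.inclusion hle a)))
  exact ht this.isAlgebraic

theorem ValuationSubring.mem_of_isAlgebraic {K L : Type*} [Field K] [Field L] [Algebra K L]
    (V : ValuationSubring L) (hV : ∀ a : K, algebraMap K L a ∈ V) {c : L} (hc : IsAlgebraic K c) :
    c ∈ V := by
  have h : IsIntegral V c := (isAlgebraic_iff_isIntegral.1 hc).map_of_comp_eq
    ((algebraMap K L).codRestrict V hV) (RingHom.id L) rfl
  obtain ⟨y, rfl⟩ := IsIntegrallyClosed.isIntegral_iff.1 h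
  exact y.2

theorem three_cluster_sum {F : Type*} [Field F] [CharZero F] {A B C u v w t τ : F}
    (hC : C ≠ 0) (huvw : u * v * w = 1)
    (hu : A * (u - v * w) = τ) (hv : B * (v - u * w) = τ) (hw : C * (w - u * v) = τ)
    (ht : t * C = A * B) (h : 4 * (A + B) = t + B * (u * w) + A * u) (hτ : τ ≠ 0) :
    A + B = 0 := by
  have h1 : τ * C * (t + B * (u * w) + A * u) = 0 := by
    linear_combination τ * ht - C * B * u * w * hu - C * A * u * hv - A * B * hw
      - A * B * C * w * huvw
  have h2 := (mul_eq_zero.1 h1).resolve_left (mul_ne_zero hτ hC)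
  rw [h2] at h
  exact (mul_eq_zero.1 h).resolve_left (by norm_num : (4 : F) ≠ 0)

theorem three_cluster_aux {F : Type*} [Field F] [CharZero F]
    {A B C m₁ n₁ m₂ n₂ m₃ n₃ t₁₂ t₁₃ t₂₃ : F} (hA : A ≠ 0) (hB : B ≠ 0) (hC : C ≠ 0)
    (h1 : m₁ * n₁ = A ^ 2) (h2 : m₂ * n₂ = B ^ 2) (h3 : m₃ * n₃ = C ^ 2)
    (hm : m₁ * m₂ * m₃ = A * B * C)
    (ht₁₂ : t₁₂ * C = A * B) (ht₁₃ : t₁₃ * B = A * C) (ht₂₃ : t₂₃ * A = B * C)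
    (v1 : 4 * (B + C) = t₂₃ + n₃ + m₂) (v2 : 4 * (A + C) = t₁₃ + n₁ + m₃)
    (v3 : 4 * (A + B) = t₁₂ + n₂ + m₁)
    (e1 : m₁ - n₁ = m₂ - n₂) (e2 : m₂ - n₂ = m₃ - n₃) : False := by
  obtain ⟨u, rfl⟩ : ∃ u, m₁ = A * u := ⟨m₁ / A, by field_simp⟩
  obtain ⟨v, rfl⟩ : ∃ v, m₂ = B * v := ⟨m₂ / B, by field_simp⟩
  obtain ⟨w, rfl⟩ : ∃ w, m₃ = C * w := ⟨m₃ / C, by field_simp⟩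
  have huvw : u * v * w = 1 := by
    apply mul_left_cancel₀ (mul_ne_zero (mul_ne_zero hA hB) hC)
    linear_combination hm
  have hu0 : u ≠ 0 := by rintro rfl; simp at huvw
  have hv0 : v ≠ 0 := by rintro rfl; simp at huvw
  have hw0 : w ≠ 0 := by rintro rfl; simp at huvw
  obtain rfl : n₁ = A * (v * w) := by
    apply mul_left_cancel₀ (mul_ne_zero hA hu0)
    linear_combination h1 - A ^ 2 * huvw
  obtain rfl : n₂ = B * (u * w) := by
    apply mul_left_cancel₀ (mul_ne_zero hB hv0)
    linear_combination h2 - B ^ 2 * huvw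
  obtain rfl : n₃ = C * (u * v) := by
    apply mul_left_cancel₀ (mul_ne_zero hC hw0)
    linear_combination h3 - C ^ 2 * huvw
  obtain ⟨τ, hu⟩ : ∃ τ, A * (u - v * w) = τ := ⟨_, rfl⟩
  have hv : B * (v - u * w) = τ := by linear_combination hu - e1
  have hw : C * (w - u * v) = τ := by linear_combination hv - e2
  by_cases hτ : τ = 0
  · subst hτ
    have hu' := (mul_eq_zero.1 hu).resolve_left hA
    have hv' := (mul_eq_zero.1 hv).resolve_left hB
    have hw' := (mul_eq_zero.1 hw).resolve_left hC
    have hAB := mul_ne_zero hA hB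
    have hu1 : u = 1 ∨ u = -1 := sq_eq_one_iff.1 (by linear_combination u * hu' + huvw)
    have hv1 : v = 1 ∨ v = -1 := sq_eq_one_iff.1 (by linear_combination v * hv' + huvw)
    have hw1 : w = u * v := by linear_combination hw'
    subst hw1
    rcases hu1 with rfl | rfl <;> rcases hv1 with rfl | rfl <;> grind
  · have a := three_cluster_sum hC huvw hu hv hw ht₁₂ (by linear_combination v3) hτ
    have b := three_cluster_sum (u := v) (v := w) (w := u) hA
      (by linear_combination huvw) (by linear_combination hv)
      (by linear_combination hw) (by linear_combination hu) ht₂₃ (by linear_combination v1) hτ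
    have c := three_cluster_sum (A := C) (B := A) (t := t₁₃) (u := w) (v := u) (w := v) hB
      (by linear_combination huvw) (by linear_combination hw)
      (by linear_combination hu) (by linear_combination hv)
      (by linear_combination ht₁₃) (by linear_combination v2) hτ
    exact hA (by linear_combination (1/2 : F) * (a - b + c))

/-- There is no degeneration in which exactly two points collapse. -/
theorem two_cluster_aux {F : Type*} [Field F] [CharZero F]
    {A p q r s V₁₃ V₁₄ V₃₄ W₂₃ W₂₄ W₃₄ : F} (hA : A ≠ 0)
    (hpq : p * q = A ^ 2) (hrs : r * s = A ^ 2)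
    (h34 : V₃₄ * r = q * W₃₄) (h13 : r * V₁₃ = p * W₂₃) (h14 : p * V₁₄ = r * W₂₄)
    (hV : V₁₃ * V₁₄ = 0)
    (e12 : 8 * A = p + q + r + s)
    (e13 : p - q + V₁₃ - V₁₄ - V₃₄ = 0) (e23 : q - p + W₂₃ - W₂₄ - W₃₄ = 0)
    (e14 : r - s + V₁₄ - V₁₃ - V₃₄ = 0) (e24 : s - r + W₂₄ - W₂₃ - W₃₄ = 0) : False := by
  have hA2 : A ^ 2 ≠ 0 := pow_ne_zero 2 hA
  have hq : q ≠ 0 := right_ne_zero_of_mul (hpq ▸ hA2)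
  have hp : p ≠ 0 := left_ne_zero_of_mul (hpq ▸ hA2)
  have hVW : V₃₄ + W₃₄ = 0 := by linear_combination (-1/2 : F) * (e13 + e14 + e23 + e24)
  have hV34 : V₃₄ = 0 := by
    have : V₃₄ * (r + q) = 0 := by linear_combination h34 + q * hVW
    rcases mul_eq_zero.1 this with h | h
    · exact h
    · have h' : p + s = 0 := by
        apply mul_left_cancel₀ hq
        linear_combination hpq - hrs + s * h
      exact absurd (show A = 0 by linear_combination (1/8 : F) * (e12 + h + h')) hA
  have hW34 : W₃₄ = 0 := by linear_combination hVW - hV34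
  subst hV34 hW34
  have hsum : p + r = q + s := by linear_combination (1/2 : F) * (e13 + e14 - e23 - e24)
  have hrq : (r - q) * (s + q) = 0 := by linear_combination hrs - hpq + q * hsum
  rcases mul_eq_zero.1 hrq with h | h
  · have hrq : r = q := by linear_combination h
    subst hrq
    have hsp : s = p := by linear_combination -hsum
    subst hsp
    have hX : 4 * A * (V₁₃ * r - V₁₄ * s) = 0 := by
      linear_combination (1/2 : F) * (V₁₃ * r - V₁₄ * s) * e12 + r * s * (e13 + e23) +
        r * h13 - s * h14
    have hX' : V₁₃ * r = V₁₄ * s := by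
      have := (mul_eq_zero.1 hX).resolve_left (mul_ne_zero (by norm_num : (4 : F) ≠ 0) hA)
      linear_combination this
    have hV0 : V₁₃ = 0 ∧ V₁₄ = 0 := by
      rcases mul_eq_zero.1 hV with h | h <;> simp_all
    obtain ⟨rfl, rfl⟩ := hV0
    have : r = s := by linear_combination -e13
    subst this
    have h2 : r = 2 * A := by linear_combination (-1/4 : F) * e12
    subst h2
    have : 3 * A ^ 2 = 0 := by linear_combination hpq
    simp_all
  · exact absurd (show A = 0 by linear_combination (1/8 : F) * (e12 + hsum + 2*h)) hA

theorem exists_line_aux {F : Type*} [Field F] [CharZero F]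
    {u₁₂₃ u₁₃₂ u₂₃₁ u₁₂₄ u₁₄₂ u₂₄₁ u₁₃₄ u₁₄₃ u₃₄₁ u₂₃₄ u₂₄₃ u₃₄₂ : F}
    (h0 : u₁₃₂ ≠ 0)
    (h1 : u₁₃₂ * u₁₂₃ = 0) (h2 : u₁₃₂ * u₂₃₁ = 0)
    (h4 : u₁₂₄ * u₁₄₂ = 0) (h5 : u₁₂₄ * u₂₄₁ = 0) (h6 : u₁₄₂ * u₂₄₁ = 0)
    (h7 : u₁₃₄ * u₁₄₃ = 0) (h8 : u₁₃₄ * u₃₄₁ = 0) (h9 : u₁₄₃ * u₃₄₁ = 0)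
    (h10 : u₂₃₄ * u₂₄₃ = 0) (h11 : u₂₃₄ * u₃₄₂ = 0) (h12 : u₂₄₃ * u₃₄₂ = 0)
    (e12 : (u₁₂₃ - u₁₃₂ - u₂₃₁) + (u₁₂₄ - u₁₄₂ - u₂₄₁) = 0)
    (e13 : (u₁₃₂ - u₁₂₃ - u₂₃₁) + (u₁₃₄ - u₁₄₃ - u₃₄₁) = 0)
    (e23 : (u₂₃₁ - u₁₂₃ - u₁₃₂) + (u₂₃₄ - u₂₄₃ - u₃₄₂) = 0)
    (e14 : (u₁₄₂ - u₁₂₄ - u₂₄₁) + (u₁₄₃ - u₁₃₄ - u₃₄₁) = 0)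
    (e24 : (u₂₄₁ - u₁₂₄ - u₁₄₂) + (u₂₄₃ - u₂₃₄ - u₃₄₂) = 0)
    (e34 : (u₃₄₁ - u₁₃₄ - u₁₄₃) + (u₃₄₂ - u₂₃₄ - u₂₄₃) = 0) :
    (u₂₄₁ ≠ 0 ∧ u₃₄₁ ≠ 0 ∧ u₃₄₂ ≠ 0) ∨ (u₁₂₄ ≠ 0 ∧ u₁₃₄ ≠ 0 ∧ u₃₄₂ ≠ 0) ∨
    (u₁₄₂ ≠ 0 ∧ u₁₃₄ ≠ 0 ∧ u₂₃₄ ≠ 0) ∨ (u₁₄₂ ≠ 0 ∧ u₁₄₃ ≠ 0 ∧ u₂₄₃ ≠ 0) := by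
  have h123 := (mul_eq_zero.1 h1).resolve_left h0
  have h231 := (mul_eq_zero.1 h2).resolve_left h0
  subst h123 h231
  have key : ∀ a b c : F, a * b = 0 → a * c = 0 → b * c = 0 →
      (b = 0 ∧ c = 0) ∨ (a = 0 ∧ c = 0) ∨ (a = 0 ∧ b = 0) := by grind
  rcases key _ _ _ h4 h5 h6 with ⟨rfl, rfl⟩ | ⟨rfl, rfl⟩ | ⟨rfl, rfl⟩ <;>
  rcases key _ _ _ h7 h8 h9 with ⟨rfl, rfl⟩ | ⟨rfl, rfl⟩ | ⟨rfl, rfl⟩ <;>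
  rcases key _ _ _ h10 h11 h12 with ⟨rfl, rfl⟩ | ⟨rfl, rfl⟩ | ⟨rfl, rfl⟩ <;>
  clear key h1 h2 h4 h5 h6 h7 h8 h9 h10 h11 h12 <;>
  grind

/-- Four pairwise distinct elements. -/
def Distinct4 {ι : Type*} (i j k l : ι) : Prop :=
  i ≠ j ∧ i ≠ k ∧ i ≠ l ∧ j ≠ k ∧ j ≠ l ∧ k ≠ l

theorem exists_distinct4 {i j : Fin 4} (h : i ≠ j) : ∃ k l, Distinct4 i j k l := by
  revert i j
  unfold Distinct4
  decide

theorem Distinct4.eq_or {a b c d : Fin 4} (h : Distinct4 a b c d) (i : Fin 4) :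
    i = a ∨ i = b ∨ i = c ∨ i = d := by
  unfold Distinct4 at h
  omega

/-- The Einstein equations of `SU(4)/T³` over a commutative ring, with Einstein constant `k`, in
terms of `z i j = 1/λᵢⱼ` and `u i j k = λᵢⱼ/(λᵢₖλⱼₖ)`. -/
structure FlagSystem {R ι : Type*} [CommRing R] (z : ι → ι → R) (u : ι → ι → ι → R)
    (k : R) : Prop where
  z_symm : ∀ i j, z i j = z j i
  u_symm : ∀ i j l, u i j l = u j i l
  u_mul_z : ∀ a b c d, Distinct4 a b c d → u a b c * z a b = z a c * z b c
  u_mul_u : ∀ a b c d, Distinct4 a b c d → u a b c * u a c b = z b c ^ 2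
  u_path : ∀ a b c d, Distinct4 a b c d → u a c b * u a d c = u a d b * u b d c
  edge : ∀ a b c d, Distinct4 a b c d →
    8 * z a b + (u a b c - u a c b - u b c a) + (u a b d - u a d b - u b d a) = 16 * k

namespace FlagSystem

variable {R ι : Type*} [CommRing R] {z : ι → ι → R} {u : ι → ι → ι → R} {k : R}

theorem map {S : Type*} [CommRing S] (H : FlagSystem z u k) (f : R →+* S) :
    FlagSystem (fun i j => f (z i j)) (fun i j l => f (u i j l)) (f k) where
  z_symm i j := by rw [H.z_symm]
  u_symm i j l := by rw [H.u_symm]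
  u_mul_z a b c d h := by simpa using congrArg f (H.u_mul_z a b c d h)
  u_mul_u a b c d h := by simpa using congrArg f (H.u_mul_u a b c d h)
  u_path a b c d h := by simpa using congrArg f (H.u_path a b c d h)
  edge a b c d h := by simpa [map_ofNat] using congrArg f (H.edge a b c d h)

theorem vertex (H : FlagSystem z u k) {a b c d : ι} (h : Distinct4 a b c d) :
    8 * (z a b + z a c + z a d) - 2 * (u b c a + u b d a + u c d a) = 48 * k := by
  have h1 := H.edge a b c d h
  have h2 := H.edge a c b d (by clear * - h; grind [Distinct4])
  have h3 := H.edge a d b c (by clear * - h; grind [Distinct4])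
  rw [H.u_symm c b a] at h2
  rw [H.u_symm d b a, H.u_symm d c a] at h3
  linear_combination h1 + h2 + h3

theorem not_three_cluster {F : Type*} [Field F] [CharZero F] {z : ι → ι → F}
    {u : ι → ι → ι → F} (H : FlagSystem z u 0) {a b c d : ι} (h : Distinct4 a b c d)
    (hab : z a b ≠ 0) (hac : z a c ≠ 0) (hbc : z b c ≠ 0)
    (had : z a d = 0) (hbd : z b d = 0) (hcd : z c d = 0) : False := by
  have t₁₂ := H.u_mul_z a b c d h
  have t₁₃ := H.u_mul_z a c b d (by clear * - h; grind [Distinct4])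
  have t₂₃ := H.u_mul_z b c a d (by clear * - h; grind [Distinct4])
  have m₁ := H.u_mul_u d b c a (by clear * - h; grind [Distinct4])
  have m₂ := H.u_mul_u d c a b (by clear * - h; grind [Distinct4])
  have m₃ := H.u_mul_u d a b c (by clear * - h; grind [Distinct4])
  have v₁ := H.vertex h
  have v₂ := H.vertex (a := b) (b := a) (c := c) (d := d) (by clear * - h; grind [Distinct4])
  have v₃ := H.vertex (a := c) (b := a) (c := b) (d := d) (by clear * - h; grind [Distinct4])
  have e₁ := H.edge a d b c (by clear * - h; grind [Distinct4])
  have e₃ := H.edge c d a b (by clear * - h; grind [Distinct4])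
  have w₁ := H.u_mul_z a b d c (by clear * - h; grind [Distinct4])
  have w₂ := H.u_mul_z a c d b (by clear * - h; grind [Distinct4])
  have w₃ := H.u_mul_z b c d a (by clear * - h; grind [Distinct4])
  have p := H.u_path c a b d (by clear * - h; grind [Distinct4])
  simp only [H.u_symm c a, H.u_symm d a, H.u_symm c b, H.u_symm d b, H.u_symm d c,
    H.z_symm b a, H.z_symm c a, H.z_symm c b, had, hbd, hcd]
    at t₁₂ t₁₃ t₂₃ m₁ m₂ m₃ v₁ v₂ v₃ e₁ e₃ p w₁ w₂ w₃
  have u₁ : u a b d = 0 := by simpa [hab] using w₁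
  have u₂ : u a c d = 0 := by simpa [hac] using w₂
  have u₃ : u b c d = 0 := by simpa [hbc] using w₃
  refine three_cluster_aux hbc hac hab (m₁ := u b d c) (n₁ := u c d b) (m₂ := u c d a)
    (n₂ := u a d c) (m₃ := u a d b) (n₃ := u b d a) (t₁₂ := u a b c) (t₁₃ := u a c b)
    (t₂₃ := u b c a) ?_ ?_ ?_ ?_ ?_ ?_ ?_ ?_ ?_ ?_ ?_ ?_
  · linear_combination m₁
  · linear_combination m₂
  · linear_combination m₃
  · linear_combination -u b d c * p + u b c a * m₁ + z b c * t₂₃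
  · linear_combination t₁₂
  · linear_combination t₁₃
  · linear_combination t₂₃
  · linear_combination v₁ / 2
  · linear_combination v₂ / 2
  · linear_combination v₃ / 2
  · linear_combination -e₃ - u₂ - u₃
  · linear_combination -e₁ - u₁ - u₂

theorem not_two_cluster {F : Type*} [Field F] [CharZero F] {z : ι → ι → F}
    {u : ι → ι → ι → F} (H : FlagSystem z u 0) {a b c d : ι} (h : Distinct4 a b c d)
    (hab : z a b ≠ 0) (hac : z a c = 0) (hbc : z b c = 0)
    (had : z a d = 0) (hbd : z b d = 0) (hcd : z c d = 0) : False := by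
  have t₁ := H.u_mul_z a b c d h
  have t₂ := H.u_mul_z a b d c (by clear * - h; grind [Distinct4])
  have m₁ := H.u_mul_u c a b d (by clear * - h; grind [Distinct4])
  have m₂ := H.u_mul_u d a b c (by clear * - h; grind [Distinct4])
  have m₃ := H.u_mul_u a c d b (by clear * - h; grind [Distinct4])
  have p₁ := H.u_path c a b d (by clear * - h; grind [Distinct4])
  have p₂ := H.u_path a b d c (by clear * - h; grind [Distinct4])
  have p₃ := H.u_path a b c d h
  have e₁ := H.edge a b c d h
  have e₂ := H.edge a c b d (by clear * - h; grind [Distinct4])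
  have e₃ := H.edge b c a d (by clear * - h; grind [Distinct4])
  have e₄ := H.edge a d b c (by clear * - h; grind [Distinct4])
  have e₅ := H.edge b d a c (by clear * - h; grind [Distinct4])
  simp only [H.u_symm b a, H.u_symm c a, H.u_symm d a, H.u_symm c b, H.u_symm d b, H.u_symm d c,
    had, hbd, hcd, hac, hbc] at t₁ t₂ m₁ m₂ m₃ p₁ p₂ p₃ e₁ e₂ e₃ e₄ e₅
  have u₁ : u a b c = 0 := by simpa [hab] using t₁
  have u₂ : u a b d = 0 := by simpa [hab] using t₂
  refine two_cluster_aux hab (p := u a c b) (q := u b c a) (r := u a d b) (s := u b d a)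
    (V₃₄ := u c d a) (W₃₄ := u c d b) (V₁₃ := u a c d) (W₂₃ := u b c d) (V₁₄ := u a d c)
    (W₂₄ := u b d c) ?_ ?_ ?_ ?_ ?_ ?_ ?_ ?_ ?_ ?_ ?_
  all_goals grind

theorem exists_line {F : Type*} [Field F] [CharZero F] {z : ι → ι → F}
    {u : ι → ι → ι → F} (H : FlagSystem z u 0) (hz : ∀ i j, i ≠ j → z i j = 0) {a b c d : ι}
    (h : Distinct4 a b c d) (hu : u a c b ≠ 0) :
    ∃ a b c d, Distinct4 a b c d ∧ u a c b ≠ 0 ∧ u a d b ≠ 0 ∧ u a d c ≠ 0 ∧ u b d c ≠ 0 := by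
  have m : ∀ i j k l, Distinct4 i j k l → u i j k * u i k j = 0 := fun i j k l h' => by
    rw [H.u_mul_u i j k l h', hz j k h'.2.2.2.1, zero_pow two_ne_zero]
  have e : ∀ i j k l, Distinct4 i j k l →
      (u i j k - u i k j - u j k i) + (u i j l - u i l j - u j l i) = 0 := fun i j k l h' => by
    simpa [hz i j h'.1] using H.edge i j k l h'
  have m1 := m a c b d (by clear * - h; grind [Distinct4])
  have m2 := m c a b d (by clear * - h; grind [Distinct4])
  have m4 := m a b d c (by clear * - h; grind [Distinct4])
  have m5 := m b a d c (by clear * - h; grind [Distinct4])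
  have m6 := m d a b c (by clear * - h; grind [Distinct4])
  have m7 := m a c d b (by clear * - h; grind [Distinct4])
  have m8 := m c a d b (by clear * - h; grind [Distinct4])
  have m9 := m d a c b (by clear * - h; grind [Distinct4])
  have m10 := m b c d a (by clear * - h; grind [Distinct4])
  have m11 := m c b d a (by clear * - h; grind [Distinct4])
  have m12 := m d b c a (by clear * - h; grind [Distinct4])
  have e1 := e a b c d h
  have e2 := e a c b d (by clear * - h; grind [Distinct4])
  have e3 := e b c a d (by clear * - h; grind [Distinct4])
  have e4 := e a d b c (by clear * - h; grind [Distinct4])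
  have e5 := e b d a c (by clear * - h; grind [Distinct4])
  have e6 := e c d a b (by clear * - h; grind [Distinct4])
  simp only [H.u_symm b a, H.u_symm c a, H.u_symm d a, H.u_symm c b, H.u_symm d b,
    H.u_symm d c] at m1 m2 m4 m5 m6 m7 m8 m9 m10 m11 m12 e1 e2 e3 e4 e5 e6
  rcases exists_line_aux hu m1 m2 m4 m5 m6 m7 m8 m9 m10 m11 m12 e1 e2 e3 e4 e5 e6 with
    ⟨h1, h2, h3⟩ | ⟨h1, h2, h3⟩ | ⟨h1, h2, h3⟩ | ⟨h1, h2, h3⟩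
  · exact ⟨d, a, b, c, by clear * - h; grind [Distinct4], H.u_symm d b a ▸ h1,
      H.u_symm d c a ▸ h2, H.u_symm d c b ▸ h3, hu⟩
  · exact ⟨a, d, b, c, by clear * - h; grind [Distinct4], h1, h2, hu, H.u_symm d c b ▸ h3⟩
  · exact ⟨a, b, d, c, by clear * - h; grind [Distinct4], h1, hu, h2, h3⟩
  · exact ⟨a, b, c, d, h, hu, h1, h2, h3⟩

theorem two_two_field_aux {F : Type*} [Field F] [CharZero F] {Z Y a₁ a₂ b₁ c₁ c₂ e₁ : F}
    (hZ : Z ≠ 0) (hY : Y ≠ 0) (ha : a₁ * a₂ = Z ^ 2) (hc : c₁ * c₂ = Y ^ 2)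
    (hab : a₁ * b₁ = Z ^ 2) (hce : c₁ * e₁ = Y ^ 2) (v₁ : 4 * Z = a₁ + b₁)
    (v₃ : 4 * Y = c₁ + e₁) (h : a₂ - a₁ + c₂ - c₁ = 0) :
    a₁ * Y + Z * c₁ ≠ 0 ∧ (a₁ * Y = Z * c₁ → Y ≠ Z) := by
  obtain rfl : b₁ = 4 * Z - a₁ := by linear_combination -v₁
  obtain rfl : e₁ = 4 * Y - c₁ := by linear_combination -v₃
  have hc1 : c₁ ≠ 0 := left_ne_zero_of_mul (hc ▸ pow_ne_zero 2 hY)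
  have ha1 : a₁ ≠ 0 := left_ne_zero_of_mul (ha ▸ pow_ne_zero 2 hZ)
  constructor
  · intro h0
    have : 8 * (Z ^ 2 * Y * c₁) = 0 := by
      linear_combination (-a₁ * Y + Z * c₁ + 4 * Z * Y) * h0 - Y ^ 2 * hab + Z ^ 2 * hce
    exact mul_ne_zero (by norm_num) (mul_ne_zero (mul_ne_zero (pow_ne_zero 2 hZ) hY) hc1) this
  · rintro h0 rfl
    obtain rfl : a₁ = c₁ := mul_right_cancel₀ hZ (by linear_combination h0)
    obtain rfl : c₂ = a₂ := mul_left_cancel₀ ha1 (by linear_combination hc - ha)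
    obtain rfl : c₂ = a₁ := by linear_combination h / 2
    obtain rfl : Y = 2 * c₂ := mul_left_cancel₀ hZ (by linear_combination -hab / 2 - ha / 2)
    have : 3 * c₂ ^ 2 = 0 := by linear_combination -ha
    exact mul_ne_zero (by norm_num) (pow_ne_zero 2 ha1) this

/-- In a local ring, if two pairs of points collapse and all four lengths between the pairs
vanish, then the Einstein constant vanishes. -/
theorem two_two_aux {S : Type*} [CommRing S] [IsLocalRing S] [Algebra ℚ S]
    {z : ι → ι → S} {u : ι → ι → ι → S} {k : S} (H : FlagSystem z u k) {a b c d : ι}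
    (h : Distinct4 a b c d) (hk : ¬IsUnit k) (hab : IsUnit (z a b)) (hcd : IsUnit (z c d))
    (hac : z a c = 0) (hbc : z b c = 0) (had : z a d = 0) (hbd : z b d = 0) : k = 0 := by
  have := algebraRat.charZero (IsLocalRing.ResidueField S)
  let ρ := IsLocalRing.residue S
  have hρ : ∀ x, IsUnit x ↔ ρ x ≠ 0 := fun x => (IsLocalRing.residue_ne_zero_iff_isUnit x).symm
  have h2 : IsUnit (2 : S) := by rw [hρ, map_ofNat]; norm_num
  have t₁ := H.u_mul_z a b c d h
  have t₂ := H.u_mul_z a b d c (by clear * - h; grind [Distinct4])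
  have t₃ := H.u_mul_z c d a b (by clear * - h; grind [Distinct4])
  have t₄ := H.u_mul_z c d b a (by clear * - h; grind [Distinct4])
  have m₁ := H.u_mul_u c a b d (by clear * - h; grind [Distinct4])
  have m₂ := H.u_mul_u d a b c (by clear * - h; grind [Distinct4])
  have m₃ := H.u_mul_u a d c b (by clear * - h; grind [Distinct4])
  have m₄ := H.u_mul_u b d c a (by clear * - h; grind [Distinct4])
  have p := H.u_path b a c d (by clear * - h; grind [Distinct4])
  have e := H.edge a c b d (by clear * - h; grind [Distinct4])
  have v₁ := H.vertex (a := a) (b := b) (c := c) (d := d) (by clear * - h; grind [Distinct4])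
  have v₂ := H.vertex (a := b) (b := a) (c := c) (d := d) (by clear * - h; grind [Distinct4])
  have v₃ := H.vertex (a := c) (b := a) (c := b) (d := d) (by clear * - h; grind [Distinct4])
  have v₄ := H.vertex (a := d) (b := a) (c := b) (d := c) (by clear * - h; grind [Distinct4])
  simp only [H.u_symm c a, H.u_symm d a, H.u_symm c b, H.u_symm d b,
    H.z_symm b a, H.z_symm c a, H.z_symm c b, H.z_symm d a, H.z_symm d b, H.z_symm d c,
    hbd, had, hac, hbc] at t₁ t₂ t₃ t₄ m₁ m₂ m₃ m₄ p e v₁ v₂ v₃ v₄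
  rw [mul_zero, hab.mul_left_eq_zero] at t₁ t₂
  rw [mul_zero, hcd.mul_left_eq_zero] at t₃ t₄
  simp only [t₁, t₂, t₃, t₄] at e v₁ v₂ v₃ v₄
  generalize z a b = Z at *
  generalize z c d = Y at *
  generalize u b c a = a₁ at *
  generalize u a c b = a₂ at *
  generalize u b d a = b₁ at *
  generalize u a d b = b₂ at *
  generalize u a d c = c₁ at *
  generalize u a c d = c₂ at *
  generalize u b d c = e₁ at *
  generalize u b c d = e₂ at *
  have ha1 : IsUnit a₁ := isUnit_of_mul_isUnit_right (m₁ ▸ hab.pow 2)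
  have hc1 : IsUnit c₁ := isUnit_of_mul_isUnit_left (m₃ ▸ hcd.pow 2)
  have hk' : ρ k = 0 := by simpa [hρ] using hk
  have r₁ : 4 * ρ Z = ρ a₁ + ρ b₁ := by
    have := congrArg ρ v₁
    simp only [map_add, map_sub, map_mul, map_ofNat, map_zero, hk'] at this
    linear_combination this / 2
  have r₃ : 4 * ρ Y = ρ c₁ + ρ e₁ := by
    have := congrArg ρ v₃
    simp only [map_add, map_sub, map_mul, map_ofNat, map_zero, hk'] at this
    linear_combination this / 2
  have hs1 : IsUnit (a₁ + b₁) := by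
    rw [hρ, map_add, ← r₁]
    exact mul_ne_zero (by norm_num) ((hρ Z).1 hab)
  have hs3 : IsUnit (c₁ + e₁) := by
    rw [hρ, map_add, ← r₃]
    exact mul_ne_zero (by norm_num) ((hρ Y).1 hcd)
  have hab1 : a₁ * b₁ = Z ^ 2 := by
    apply hs1.mul_left_cancel
    have : a₁ + b₁ = a₂ + b₂ := h2.mul_left_cancel (by linear_combination v₂ - v₁)
    linear_combination a₁ * b₁ * this + b₁ * m₁ + a₁ * m₂
  have hce1 : c₁ * e₁ = Y ^ 2 := by
    apply hs3.mul_left_cancel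
    have : c₁ + e₁ = c₂ + e₂ := h2.mul_left_cancel (by linear_combination v₄ - v₃)
    linear_combination c₁ * e₁ * this + e₁ * m₃ + c₁ * m₄
  obtain ⟨f₁, f₂⟩ := two_two_field_aux (Z := ρ Z) (Y := ρ Y) (a₁ := ρ a₁) (a₂ := ρ a₂)
    (b₁ := ρ b₁) (c₁ := ρ c₁) (c₂ := ρ c₂) (e₁ := ρ e₁) ((hρ Z).1 hab) ((hρ Y).1 hcd)
    (by simpa [mul_comm] using congrArg ρ m₁) (by simpa [mul_comm] using congrArg ρ m₃)
    (by simpa using congrArg ρ hab1) (by simpa using congrArg ρ hce1) r₁ r₃ (by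
      have := congrArg ρ e
      simp only [map_add, map_sub, map_mul, map_ofNat, map_zero, hk'] at this
      linear_combination this)
  have hf : IsUnit (a₁ * Y + Z * c₁) := by
    simpa only [hρ, map_add, map_mul] using f₁
  have h1 : a₁ * Y = Z * c₁ := by
    apply hf.mul_left_cancel
    linear_combination c₁ * a₁ * p - a₁ ^ 2 * hce1 + c₁ ^ 2 * hab1
  have h3 : e₁ * Z = b₁ * Y := by
    apply ha1.mul_left_cancel
    linear_combination Z * p - b₁ * h1
  have hYZ : IsUnit (48 * (Y - Z)) := by
    rw [hρ, map_mul, map_ofNat, map_sub]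
    exact mul_ne_zero (by norm_num) (sub_ne_zero.2 (f₂ (by simpa using congrArg ρ h1)))
  apply hYZ.mul_left_cancel
  linear_combination -Y * v₁ + Z * v₃ - 2 * h1 + 2 * h3

theorem exists_isUnit_mul_eq {R : Type*} [CommRing R] [IsLocalRing R] [Algebra ℚ R]
    {z : ι → ι → R} {u : ι → ι → ι → R} {k : R} (H : FlagSystem z u k) {a b c d : ι}
    (h : Distinct4 a b c d) (hz : ∀ i j, i ≠ j → ¬IsUnit (z i j)) (h₁ : IsUnit (u a c b))
    (h₂ : IsUnit (u a d b)) (h₃ : IsUnit (u a d c)) : ∃ e, IsUnit e ∧ 48 * k = z a b * e := by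
  have := algebraRat.charZero (IsLocalRing.ResidueField R)
  obtain ⟨p, hp⟩ := h₁.exists_right_inv
  obtain ⟨q, hq⟩ := h₂.exists_right_inv
  obtain ⟨r, hr⟩ := h₃.exists_right_inv
  have t₁ := H.u_mul_z a c b d (by clear * - h; grind [Distinct4])
  have t₂ := H.u_mul_z a d b c (by clear * - h; grind [Distinct4])
  have m₁ := H.u_mul_u c a b d (by clear * - h; grind [Distinct4])
  have m₂ := H.u_mul_u d a b c (by clear * - h; grind [Distinct4])
  have m₃ := H.u_mul_u d a c b (by clear * - h; grind [Distinct4])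
  have v := H.vertex h
  simp only [H.u_symm c a, H.u_symm d a, H.u_symm c b, H.u_symm d b, H.u_symm d c,
    H.z_symm c b, H.z_symm d b] at t₁ t₂ m₁ m₂ m₃ v
  refine ⟨8 + 8 * z b c * p + 8 * z b d * q - 2 * z a b * p - 2 * z a b * q
    - 2 * z b c * z a c * p * r, ?_, ?_⟩
  · have hρ : ∀ i j, i ≠ j → IsLocalRing.residue R (z i j) = 0 := fun i j hij => by
      simpa using hz i j hij
    rw [← IsLocalRing.residue_ne_zero_iff_isUnit]
    simp only [map_add, map_sub, map_mul, map_ofNat, hρ a b h.1, hρ b c h.2.2.2.1,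
      hρ b d h.2.2.2.2.1]
    norm_num
  · have z₁ : z a c = z a b * z b c * p := by linear_combination p * t₁ - z a c * hp
    have z₂ : z a d = z a b * z b d * q := by linear_combination q * t₂ - z a d * hq
    have y₁ : u b c a = z a b ^ 2 * p := by linear_combination p * m₁ - u b c a * hp
    have y₂ : u b d a = z a b ^ 2 * q := by linear_combination q * m₂ - u b d a * hq
    have y₃ : u c d a = z a c ^ 2 * r := by linear_combination r * m₃ - u c d a * hr
    linear_combination -v + 8 * z₁ + 8 * z₂ - 2 * y₁ - 2 * y₂ - 2 * y₃ - 2 * r * z a c * z₁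

theorem not_line {R : Type*} [CommRing R] [IsDomain R] [IsLocalRing R] [Algebra ℚ R]
    {z : ι → ι → R} {u : ι → ι → ι → R} {k c₀ : R} (H : FlagSystem z u k) {a b c d : ι}
    (h : Distinct4 a b c d) (hz : ∀ i j, i ≠ j → ¬IsUnit (z i j))
    (hz0 : ∀ i j, i ≠ j → z i j ≠ 0)
    (hk : k ^ 6 = c₀ * (z a b * z a c * z a d * z b c * z b d * z c d)) (h₁ : IsUnit (u a c b))
    (h₂ : IsUnit (u a d b)) (h₃ : IsUnit (u a d c)) (h₄ : IsUnit (u b d c)) : False := by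
  obtain ⟨e, he, hek⟩ := H.exists_isUnit_mul_eq h hz h₁ h₂ h₃
  obtain ⟨e', he', hek'⟩ := H.exists_isUnit_mul_eq (a := d) (b := c) (c := b) (d := a)
    (by clear * - h; grind [Distinct4]) hz (H.u_symm d b c ▸ h₄) (H.u_symm d a c ▸ h₃)
    (H.u_symm d a b ▸ h₂)
  have t₁ := H.u_mul_z a c b d (by clear * - h; grind [Distinct4])
  have t₂ := H.u_mul_z a d b c (by clear * - h; grind [Distinct4])
  have t₃ := H.u_mul_z b d c a (by clear * - h; grind [Distinct4])
  rw [H.z_symm c b] at t₁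
  rw [H.z_symm d b] at t₂
  rw [H.z_symm d c] at t₃ hek'
  have key : z a b ^ 3 * z c d ^ 3 * (u a c b * u a d b * u b d c ^ 2 * e ^ 3 * e' ^ 3) =
      z a b ^ 3 * z c d ^ 3 * (48 ^ 6 * c₀ * z b c ^ 4) := by
    calc _ = (z a b * e) ^ 3 * (z c d * e') ^ 3 * (u a c b * u a d b * u b d c ^ 2) := by ring
      _ = 48 ^ 6 * k ^ 6 * (u a c b * u a d b * u b d c ^ 2) := by rw [← hek, ← hek']; ring
      _ = 48 ^ 6 * c₀ * (z a b * z b c * z c d * (u a c b * z a c) * (u a d b * z a d) *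
          (u b d c * z b d) * u b d c) := by rw [hk]; ring
      _ = 48 ^ 6 * c₀ * (z a b * z b c * z c d * (z a b * z b c) * z a b *
          (u b d c * z b d) ^ 2) := by rw [t₁, t₂]; ring
      _ = _ := by rw [t₃]; ring
  have key' := mul_left_cancel₀ (mul_ne_zero (pow_ne_zero 3 (hz0 a b h.1))
    (pow_ne_zero 3 (hz0 c d h.2.2.2.2.2))) key
  have : IsUnit (48 ^ 6 * c₀ * z b c ^ 4) :=
    key' ▸ (((h₁.mul h₂).mul (h₄.pow 2)).mul (he.pow 3)).mul (he'.pow 3)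
  exact hz b c h.2.2.2.1 ((isUnit_pow_iff four_ne_zero).1 (isUnit_of_mul_isUnit_right this))

theorem not_two_two {R : Type*} [CommRing R] [IsDomain R] [IsLocalRing R] [Algebra ℚ R]
    {z : ι → ι → R} {u : ι → ι → ι → R} {k : R} (H : FlagSystem z u k) {a b c d : ι}
    (h : Distinct4 a b c d) (hab : IsUnit (z a b)) (hcd : IsUnit (z c d))
    (hac : ¬IsUnit (z a c)) (hac0 : z a c ≠ 0)
    (hk : ∃ c₀, IsUnit c₀ ∧ k ^ 6 = c₀ * (z a b * z a c * z a d * z b c * z b d * z c d)) :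
    False := by
  have m₁ := H.u_mul_u c a b d (by clear * - h; grind [Distinct4])
  have m₂ := H.u_mul_u a d c b (by clear * - h; grind [Distinct4])
  have m₃ := H.u_mul_u b d c a (by clear * - h; grind [Distinct4])
  have t₁ := H.u_mul_z b c a d (by clear * - h; grind [Distinct4])
  have t₂ := H.u_mul_z a d c b (by clear * - h; grind [Distinct4])
  have t₃ := H.u_mul_z b d c a (by clear * - h; grind [Distinct4])
  simp only [H.u_symm c a, H.u_symm c b, H.z_symm b a, H.z_symm c a, H.z_symm d c]
    at m₁ m₂ m₃ t₁ t₂ t₃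
  obtain ⟨p, hp⟩ : IsUnit (u b c a) := isUnit_of_mul_isUnit_right (m₁ ▸ hab.pow 2)
  obtain ⟨q, hq⟩ : IsUnit (u a d c) := isUnit_of_mul_isUnit_left (m₂ ▸ hcd.pow 2)
  obtain ⟨r, hr⟩ : IsUnit (u b d c) := isUnit_of_mul_isUnit_left (m₃ ▸ hcd.pow 2)
  rw [← hp] at t₁
  rw [← hq] at t₂
  rw [← hr] at t₃
  obtain ⟨w₁, hw₁, hbc⟩ : ∃ w, IsUnit w ∧ z b c = w * z a c :=
    ⟨_, (p⁻¹).isUnit.mul hab, by rw [mul_assoc, ← t₁, Units.inv_mul_cancel_left]⟩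
  obtain ⟨w₂, hw₂, had⟩ : ∃ w, IsUnit w ∧ z a d = w * z a c :=
    ⟨_, (q⁻¹).isUnit.mul hcd, by
      rw [mul_assoc, mul_comm (z c d), ← t₂, Units.inv_mul_cancel_left]⟩
  obtain ⟨w₃, hw₃, hbd⟩ : ∃ w, IsUnit w ∧ z b d = w * z a c :=
    ⟨_, ((r⁻¹).isUnit.mul hcd).mul hw₁, by
      rw [mul_assoc, ← hbc, mul_assoc, mul_comm (z c d), ← t₃, Units.inv_mul_cancel_left]⟩
  obtain ⟨c₀, hc₀, hk⟩ := hk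
  let π := Ideal.Quotient.mk (Ideal.span {z a c})
  have : Nontrivial (R ⧸ Ideal.span {z a c}) :=
    Ideal.Quotient.nontrivial_iff.2 (by rwa [Ne, Ideal.span_singleton_eq_top])
  have : IsLocalRing (R ⧸ Ideal.span {z a c}) :=
    .of_surjective' π Ideal.Quotient.mk_surjective
  have hδ : π (z a c) = 0 := Ideal.Quotient.eq_zero_iff_mem.2 (Ideal.mem_span_singleton_self _)
  have hπk : ¬IsUnit (π k) := by
    intro hu
    have := hu.pow 6
    rw [← map_pow, hk] at this
    simp [hδ] at this
  have hk0 := two_two_aux (H.map π) h hπk (hab.map π) (hcd.map π) hδ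
    (by simp [hbc, hδ]) (by simp [had, hδ]) (by simp [hbd, hδ])
  obtain ⟨t, ht⟩ := Ideal.mem_span_singleton.1 (Ideal.Quotient.eq_zero_iff_mem.1 hk0)
  have key : z a c ^ 4 * (z a c * (z a c * t ^ 6)) =
      z a c ^ 4 * (c₀ * z a b * w₁ * w₂ * w₃ * z c d) := by
    calc _ = k ^ 6 := by rw [ht]; ring
      _ = _ := by rw [hk, hbc, had, hbd]; ring
  have key' := mul_left_cancel₀ (pow_ne_zero 4 hac0) key
  refine hac (isUnit_of_mul_isUnit_left (y := z a c * t ^ 6) ?_)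
  rw [key']
  exact ((((hc₀.mul hab).mul hw₁).mul hw₂).mul hw₃).mul hcd

/-- Einstein solutions over a local ring, rescaled to be integral and primitive, do not degenerate. -/
theorem not_degenerate {R : Type*} [CommRing R] [IsDomain R] [IsLocalRing R] [Algebra ℚ R]
    {z : Fin 4 → Fin 4 → R} {u : Fin 4 → Fin 4 → Fin 4 → R} {k : R} (H : FlagSystem z u k)
    (hz0 : ∀ i j, i ≠ j → z i j ≠ 0)
    (hk : ∀ a b c d, Distinct4 a b c d → ∃ c₀, IsUnit c₀ ∧
      k ^ 6 = c₀ * (z a b * z a c * z a d * z b c * z b d * z c d))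
    (hu : ∃ a b c d, Distinct4 a b c d ∧ IsUnit (u a b c))
    (hz : ∃ i j, i ≠ j ∧ ¬IsUnit (z i j)) : False := by
  have := algebraRat.charZero (IsLocalRing.ResidueField R)
  let ρ := IsLocalRing.residue R
  have hρ : ∀ x, IsUnit x ↔ ρ x ≠ 0 := fun x => (IsLocalRing.residue_ne_zero_iff_isUnit x).symm
  have hρ0 : ∀ x, ¬IsUnit x → ρ x = 0 := fun x => by simp [hρ]
  have hkn : ¬IsUnit k := by
    obtain ⟨i, j, hij, h⟩ := hz
    obtain ⟨a, b, hd⟩ := exists_distinct4 hij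
    obtain ⟨c₀, -, h6⟩ := hk i j a b hd
    intro hu
    have h' := h6 ▸ hu.pow 6
    simp only [IsUnit.mul_iff] at h'
    tauto
  have H₀ : FlagSystem (fun i j => ρ (z i j)) (fun i j l => ρ (u i j l)) 0 :=
    hρ0 k hkn ▸ H.map ρ
  have htrans : ∀ a b c d, Distinct4 a b c d → IsUnit (z a b) → IsUnit (z b c) →
      IsUnit (z a c) := fun a b c d h h1 h2 =>
    isUnit_of_mul_isUnit_right ((H.u_mul_z a c b d (by clear * - h; grind [Distinct4])).symm ▸
      h1.mul (H.z_symm b c ▸ h2))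
  have htriple : ∀ a b c d, Distinct4 a b c d → IsUnit (z a b) → ¬IsUnit (z b c) := by
    intro a b c d h h1 h2
    have h3 := htrans a b c d h h1 h2
    by_cases h4 : IsUnit (z a d) ∨ IsUnit (z b d) ∨ IsUnit (z c d)
    · have hsymm : ∀ i j, IsUnit (z i j) → IsUnit (z j i) := fun i j h => H.z_symm i j ▸ h
      have h5 : IsUnit (z a d) ∧ IsUnit (z b d) ∧ IsUnit (z c d) := by
        rcases h4 with h4 | h4 | h4
        · exact ⟨h4, htrans b a d c (by clear * - h; grind [Distinct4]) (hsymm _ _ h1) h4,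
            htrans c a d b (by clear * - h; grind [Distinct4]) (hsymm _ _ h3) h4⟩
        · exact ⟨htrans a b d c (by clear * - h; grind [Distinct4]) h1 h4, h4,
            htrans c b d a (by clear * - h; grind [Distinct4]) (hsymm _ _ h2) h4⟩
        · exact ⟨htrans a c d b (by clear * - h; grind [Distinct4]) h3 h4,
            htrans b c d a (by clear * - h; grind [Distinct4]) h2 h4, h4⟩
      obtain ⟨i, j, hij, h6⟩ := hz
      apply h6
      rcases h.eq_or i with rfl | rfl | rfl | rfl <;>
      rcases h.eq_or j with rfl | rfl | rfl | rfl <;>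
        first | exact absurd rfl hij | simp only [h1, h2, h3, h5, hsymm]
    · push Not at h4
      exact not_three_cluster H₀ h ((hρ _).1 h1) ((hρ _).1 h3) ((hρ _).1 h2)
        (hρ0 _ h4.1) (hρ0 _ h4.2.1)
        (hρ0 _ h4.2.2)
  by_cases hunit : ∃ a b, a ≠ b ∧ IsUnit (z a b)
  · obtain ⟨a, b, hab, h1⟩ := hunit
    obtain ⟨c, d, h⟩ := exists_distinct4 hab
    have hbc := htriple a b c d h h1
    have hbd := htriple a b d c (by clear * - h; grind [Distinct4]) h1
    have hac := htriple b a c d (by clear * - h; grind [Distinct4]) (H.z_symm a b ▸ h1)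
    have had := htriple b a d c (by clear * - h; grind [Distinct4]) (H.z_symm a b ▸ h1)
    by_cases hcd : IsUnit (z c d)
    · exact H.not_two_two h h1 hcd hac (hz0 a c h.2.1) (hk a b c d h)
    · exact not_two_cluster H₀ h ((hρ _).1 h1) (hρ0 _ hac) (hρ0 _ hbc) (hρ0 _ had)
        (hρ0 _ hbd) (hρ0 _ hcd)
  · push Not at hunit
    obtain ⟨a, b, c, d, h, hu⟩ := hu
    obtain ⟨a, b, c, d, h, h1, h2, h3, h4⟩ := exists_line H₀ (fun i j hij => hρ0 _ (hunit i j hij))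
      (a := a) (b := c) (c := b) (d := d) (by clear * - h; grind [Distinct4]) ((hρ _).1 hu)
    obtain ⟨c₀, -, h6⟩ := hk a b c d h
    exact H.not_line h hunit hz0 h6 ((hρ _).2 h1) ((hρ _).2 h2) ((hρ _).2 h3) ((hρ _).2 h4)

theorem of_inv {L : Type*} [Field L] {x : ι → ι → L} {k : L} (hx : ∀ i j, i ≠ j → x i j ≠ 0)
    (hs : ∀ i j, x i j = x j i)
    (he : ∀ a b c d, Distinct4 a b c d →
      8 * (x a b)⁻¹ + (x a b / (x a c * x b c) - x a c / (x a b * x c b) - x b c / (x b a * x c a))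
        + (x a b / (x a d * x b d) - x a d / (x a b * x d b) - x b d / (x b a * x d a)) =
        16 * k) :
    FlagSystem (fun i j => (x i j)⁻¹) (fun i j l => x i j / (x i l * x j l)) k where
  z_symm i j := by rw [hs]
  u_symm i j l := by rw [hs i j, mul_comm]
  u_mul_z a b c d h := by
    have := hx a b h.1
    field_simp
  u_mul_u a b c d h := by
    have := hx a b h.1
    have := hx a c h.2.1
    have := hx b c h.2.2.2.1
    simp only [hs c b]
    field_simp
  u_path a b c d h := by
    have := hx a c h.2.1
    have := hx a d h.2.2.1
    have := hx c b h.2.2.2.1.symm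
    have := hx b d h.2.2.2.2.1
    have := hx b c h.2.2.2.1
    simp only [hs c b, hs d b, hs d c]
    field_simp
  edge a b c d h := he a b c d h

theorem smul {R : Type*} [CommRing R] {z : ι → ι → R} {u : ι → ι → ι → R} {k : R}
    (H : FlagSystem z u k) (t : R) :
    FlagSystem (fun i j => t * z i j) (fun i j l => t * u i j l) (t * k) where
  z_symm i j := by rw [H.z_symm]
  u_symm i j l := by rw [H.u_symm]
  u_mul_z a b c d h := by linear_combination t ^ 2 * H.u_mul_z a b c d h
  u_mul_u a b c d h := by linear_combination t ^ 2 * H.u_mul_u a b c d h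
  u_path a b c d h := by linear_combination t ^ 2 * H.u_path a b c d h
  edge a b c d h := by linear_combination t * H.edge a b c d h

theorem comap {R S : Type*} [CommRing R] [CommRing S] {f : R →+* S} (hf : Function.Injective f)
    {z : ι → ι → R} {u : ι → ι → ι → R} {k : R} {z' : ι → ι → S} {u' : ι → ι → ι → S} {k' : S}
    (H : FlagSystem z' u' k') (hzs : ∀ i j, z i j = z j i) (hus : ∀ i j l, u i j l = u j i l)
    (hz : ∀ i j, i ≠ j → f (z i j) = z' i j)
    (hu : ∀ a b c d, Distinct4 a b c d → f (u a b c) = u' a b c) (hk : f k = k') :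
    FlagSystem z u k where
  z_symm := hzs
  u_symm := hus
  u_mul_z a b c d h := hf <| by
    rw [map_mul, map_mul, hu a b c d h, hz a b h.1, hz a c h.2.1, hz b c h.2.2.2.1,
      H.u_mul_z a b c d h]
  u_mul_u a b c d h := hf <| by
    rw [map_mul, map_pow, hu a b c d h, hz b c h.2.2.2.1,
      hu a c b d (by clear * - h; grind [Distinct4]), H.u_mul_u a b c d h]
  u_path a b c d h := hf <| by
    rw [map_mul, map_mul, hu a c b d (by clear * - h; grind [Distinct4]),
      hu a d c b (by clear * - h; grind [Distinct4]),
      hu a d b c (by clear * - h; grind [Distinct4]),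
      hu b d c a (by clear * - h; grind [Distinct4]), H.u_path a b c d h]
  edge a b c d h := hf <| by
    simp only [map_add, map_sub, map_mul, map_ofNat]
    rw [hz a b h.1, hk, hu a b c d h, hu a c b d (by clear * - h; grind [Distinct4]),
      hu b c a d (by clear * - h; grind [Distinct4]),
      hu a b d c (by clear * - h; grind [Distinct4]),
      hu a d b c (by clear * - h; grind [Distinct4]),
      hu b d a c (by clear * - h; grind [Distinct4]), H.edge a b c d h]

/-- The scale-invariant power of the Einstein constant is algebraic: every derivation kills it. -/
theorem isAlgebraic_invariant {K L : Type*} [Field K] [CharZero K] [Field L] [Algebra K L]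
    {x : ι → ι → L} {k : L} (hx : ∀ i j, i ≠ j → x i j ≠ 0)
    (H : FlagSystem (fun i j => (x i j)⁻¹) (fun i j l => x i j / (x i l * x j l)) k)
    {a b c d : ι} (h : Distinct4 a b c d) :
    IsAlgebraic K (k ^ 6 * (x a b * x a c * x a d * x b c * x b d * x c d)) := by
  by_contra hc
  obtain ⟨D, hD⟩ := exists_derivation_ne_zero hc
  apply hD
  have : CharZero L := charZero_of_injective_algebraMap (algebraMap K L).injective
  have hy : ∀ i j, i ≠ j → ∃ y, D (x i j) = x i j * y := fun i j hij =>
    ⟨D (x i j) / x i j, by rw [mul_div_cancel₀ _ (hx i j hij)]⟩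
  obtain ⟨y₁, h₁⟩ := hy a b h.1
  obtain ⟨y₂, h₂⟩ := hy a c h.2.1
  obtain ⟨y₃, h₃⟩ := hy a d h.2.2.1
  obtain ⟨y₄, h₄⟩ := hy b c h.2.2.2.1
  obtain ⟨y₅, h₅⟩ := hy b d h.2.2.2.2.1
  obtain ⟨y₆, h₆⟩ := hy c d h.2.2.2.2.2
  have e₁ := H.edge a b c d h
  have e₂ := H.edge a c b d (by clear * - h; grind [Distinct4])
  have e₃ := H.edge a d b c (by clear * - h; grind [Distinct4])
  have e₄ := H.edge b c a d (by clear * - h; grind [Distinct4])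
  have e₅ := H.edge b d a c (by clear * - h; grind [Distinct4])
  have e₆ := H.edge c d a b (by clear * - h; grind [Distinct4])
  have hs : ∀ i j, x i j = x j i := fun i j => inv_injective (H.z_symm i j)
  simp only [hs b a, hs c a, hs d a, hs c b, hs d b, hs d c] at e₁ e₂ e₃ e₄ e₅ e₆
  have hmul : ∀ {v w y y' : L}, D v = v * y → D w = w * y' → D (v * w) = v * w * (y + y') := by
    intro v w y y' hv hw
    rw [D.leibniz, hv, hw, smul_eq_mul, smul_eq_mul]
    ring
  have hinv : ∀ {v y : L}, D v = v * y → D v⁻¹ = v⁻¹ * -y := by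
    intro v y hv
    rcases eq_or_ne v 0 with rfl | hv0
    · simp
    · rw [D.leibniz_inv, hv, smul_eq_mul]
      field_simp
  have hdiv : ∀ {v w s y y' y'' : L}, D v = v * y → D w = w * y' → D s = s * y'' →
      D (v / (w * s)) = v / (w * s) * (y + -(y' + y'')) := fun hv hw hs => by
    rw [div_eq_mul_inv]
    exact hmul hv (hinv (hmul hw hs))
  have hsum := congrArg D (congrArg₂ (· + ·) e₁ (congrArg₂ (· + ·) e₂ (congrArg₂ (· + ·) e₃
    (congrArg₂ (· + ·) e₄ (congrArg₂ (· + ·) e₅ e₆)))))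
  have hn : ∀ (n : ℕ) (v : L), D ((n : L) * v) = (n : L) * D v := by
    intro n v
    simp [D.leibniz]
  have h8 : ∀ v : L, D (8 * v) = 8 * D v := by simpa using hn 8
  have h16 : ∀ v : L, D (16 * v) = 16 * D v := by simpa using hn 16
  simp only [map_add, map_sub, h8, h16, hinv h₁, hinv h₂, hinv h₃, hinv h₄, hinv h₅, hinv h₆,
    hdiv h₁ h₂ h₄, hdiv h₁ h₄ h₂, hdiv h₁ h₃ h₅, hdiv h₁ h₅ h₃, hdiv h₂ h₁ h₄, hdiv h₂ h₄ h₁,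
    hdiv h₂ h₃ h₆, hdiv h₂ h₆ h₃, hdiv h₃ h₁ h₅, hdiv h₃ h₅ h₁, hdiv h₃ h₂ h₆, hdiv h₃ h₆ h₂,
    hdiv h₄ h₁ h₂, hdiv h₄ h₂ h₁, hdiv h₄ h₅ h₆, hdiv h₄ h₆ h₅, hdiv h₅ h₁ h₃, hdiv h₅ h₃ h₁,
    hdiv h₅ h₄ h₆, hdiv h₅ h₆ h₄, hdiv h₆ h₂ h₃, hdiv h₆ h₃ h₂, hdiv h₆ h₄ h₅,
    hdiv h₆ h₅ h₄] at hsum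
  have hk : 6 * D k = -(k * (y₁ + y₂ + y₃ + y₄ + y₅ + y₆)) := by
    have : (16 : L) ≠ 0 := by norm_num
    apply mul_left_cancel₀ this
    linear_combination -hsum - y₁ * e₁ - y₂ * e₂ - y₃ * e₃ - y₄ * e₄ - y₅ * e₅ - y₆ * e₆
  rw [D.leibniz, D.leibniz_pow, hmul (hmul (hmul (hmul (hmul h₁ h₂) h₃) h₄) h₅) h₆]
  simp only [smul_eq_mul, nsmul_eq_mul]
  push_cast
  linear_combination k ^ 5 * (x a b * x a c * x a d * x b c * x b d * x c d) * hk

end FlagSystem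

/-- A normalized Einstein solution with nonzero Einstein constant in an extension field of `K` has
algebraic coordinates. -/
theorem FlagSystem.isAlgebraic_of_normalized {K L : Type*} [Field K] [CharZero K] [Field L]
    [Algebra K L] {x : Fin 4 → Fin 4 → L} {k : L} (hx : ∀ i j, i ≠ j → x i j ≠ 0)
    (H : FlagSystem (fun i j => (x i j)⁻¹) (fun i j l => x i j / (x i l * x j l)) k)
    (hk : k ≠ 0) (h01 : x 0 1 = 1) {i j : Fin 4} (hij : i ≠ j) : IsAlgebraic K (x i j) := by
  classical
  by_contra ht
  have hcz : CharZero L := charZero_of_injective_algebraMap (algebraMap K L).injective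
  obtain ⟨V, hV, hxV⟩ := exists_valuationSubring ht
  have hQ : ∀ q : ℚ, algebraMap ℚ L q ∈ V := fun q => by
    simpa using hV (q : K)
  let : Algebra ℚ V := ((algebraMap ℚ L).codRestrict V hQ).toAlgebra
  set u : Fin 4 → Fin 4 → Fin 4 → L := fun i j l => x i j / (x i l * x j l) with hu
  have hu0 : ∀ a b c d, Distinct4 a b c d → u a b c ≠ 0 := fun a b c d h =>
    div_ne_zero (hx _ _ h.1) (mul_ne_zero (hx _ _ h.2.1) (hx _ _ h.2.2.2.1))
  obtain ⟨⟨⟨a, b, c, d⟩, h⟩, hmax⟩ :=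
    exists_max_image (univ : Finset {q : Fin 4 × Fin 4 × Fin 4 × Fin 4 //
      Distinct4 q.1 q.2.1 q.2.2.1 q.2.2.2})
      (fun q => V.valuation (u q.1.1 q.1.2.1 q.1.2.2.1))
      ⟨⟨(0, 1, 2, 3), by simp [Distinct4]⟩, mem_univ _⟩ |>.imp fun _ h => h.2
  simp only [mem_univ, true_imp_iff, Subtype.forall, Prod.forall] at h hmax
  set θ := u a b c with hθ
  have hθ0 : θ ≠ 0 := hu0 a b c d h
  have huV : ∀ p q r s, Distinct4 p q r s → θ⁻¹ * u p q r ∈ V := fun p q r s h' => by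
    rw [← V.valuation_le_one_iff, map_mul, map_inv₀, inv_mul_le_one₀]
    · exact hmax p q r s h'
    · simpa [zero_lt_iff] using hθ0
  have Hθ := H.smul θ⁻¹
  have hzV : ∀ p q, p ≠ q → θ⁻¹ * (x p q)⁻¹ ∈ V := fun p q hpq => by
    obtain ⟨r, s, h'⟩ := exists_distinct4 hpq
    have hr : Distinct4 r p q s := by clear * - h'; grind [Distinct4]
    have hr' : Distinct4 r q p s := by clear * - h'; grind [Distinct4]
    have e := Hθ.u_mul_u r p q s hr
    have hz0 : θ⁻¹ * (x p q)⁻¹ ≠ 0 := mul_ne_zero (inv_ne_zero hθ0) (inv_ne_zero (hx p q hpq))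
    rcases V.mem_or_inv_mem (θ⁻¹ * (x p q)⁻¹) with hm | hm
    · exact hm
    · have := V.mul_mem _ _ (V.mul_mem _ _ (huV r p q s hr) (huV r q p s hr')) hm
      rw [e] at this
      rwa [sq, mul_assoc, mul_inv_cancel₀ hz0, mul_one] at this
  have hkV : θ⁻¹ * k ∈ V := by
    have e := Hθ.edge a b c d h
    have h8 : (8 : L) ∈ V := by simp
    have h16 : (16 : L)⁻¹ ∈ V := by simpa using hQ (16⁻¹)
    have : 16 * (θ⁻¹ * k) ∈ V := by
      rw [← e]
      refine add_mem (add_mem (mul_mem h8 (hzV _ _ h.1)) (sub_mem (sub_mem ?_ ?_) ?_))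
        (sub_mem (sub_mem ?_ ?_) ?_)
      · exact huV a b c d h
      · exact huV a c b d (by clear * - h; grind [Distinct4])
      · exact huV b c a d (by clear * - h; grind [Distinct4])
      · exact huV a b d c (by clear * - h; grind [Distinct4])
      · exact huV a d b c (by clear * - h; grind [Distinct4])
      · exact huV b d a c (by clear * - h; grind [Distinct4])
    simpa using mul_mem h16 this
  let lift : L → V := fun y => if hy : y ∈ V then ⟨y, hy⟩ else 0
  have hlift : ∀ y, y ∈ V → V.subtype (lift y) = y := fun y hy => by simp [lift, hy]
  have hinj : Function.Injective V.subtype := Subtype.val_injective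
  have HV : FlagSystem (fun p q => lift (θ⁻¹ * (x p q)⁻¹)) (fun p q r => lift (θ⁻¹ * u p q r))
      (lift (θ⁻¹ * k)) :=
    Hθ.comap hinj (fun p q => by rw [Hθ.z_symm p q]) (fun p q r => by rw [Hθ.u_symm p q r])
      (fun p q hpq => hlift _ (hzV p q hpq)) (fun p q r s h' => hlift _ (huV p q r s h'))
      (hlift _ hkV)
  refine HV.not_degenerate ?_ ?_ ⟨a, b, c, d, h, ?_⟩ ⟨i, j, hij, ?_⟩
  · intro p q hpq h0
    have := hlift _ (hzV p q hpq)
    rw [h0, map_zero] at this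
    exact mul_ne_zero (inv_ne_zero hθ0) (inv_ne_zero (hx p q hpq)) this.symm
  · intro p q r s h'
    have hx₁ := hx p q h'.1
    have hx₂ := hx p r h'.2.1
    have hx₃ := hx p s h'.2.2.1
    have hx₄ := hx q r h'.2.2.2.1
    have hx₅ := hx q s h'.2.2.2.2.1
    have hx₆ := hx r s h'.2.2.2.2.2
    have halg := isAlgebraic_invariant (K := K) hx H h'
    have hc := V.mem_of_isAlgebraic hV halg
    have hc' := V.mem_of_isAlgebraic hV halg.inv
    refine ⟨⟨_, hc⟩, IsUnit.of_mul_eq_one ⟨_, hc'⟩ (Subtype.ext (mul_inv_cancel₀ ?_)), hinj ?_⟩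
    · positivity
    · simp only [map_pow, map_mul, hlift _ hkV, hlift _ (hzV p q h'.1),
        hlift _ (hzV p r h'.2.1), hlift _ (hzV p s h'.2.2.1), hlift _ (hzV q r h'.2.2.2.1),
        hlift _ (hzV q s h'.2.2.2.2.1), hlift _ (hzV r s h'.2.2.2.2.2)]
      change (θ⁻¹ * k) ^ 6 = k ^ 6 * (x p q * x p r * x p s * x q r * x q s * x r s) * _
      field_simp
  · have : lift (θ⁻¹ * u a b c) = 1 := hinj (by
      rw [hlift _ (huV a b c d h), inv_mul_cancel₀ hθ0, map_one])
    rw [this]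
    exact isUnit_one
  · rintro ⟨y, hy⟩
    have h1 : V.subtype (y⁻¹ : Vˣ) * (θ⁻¹ * (x i j)⁻¹) = 1 := by
      rw [← hlift _ (hzV i j hij), ← hy, ← map_mul, Units.inv_mul, map_one]
    have h2 : V.subtype (y⁻¹ : Vˣ) * (θ⁻¹ * (x 0 1)⁻¹) = x i j := by
      rw [h01]
      have := hx i j hij
      field_simp at h1 ⊢
      exact h1
    exact hxV (h2 ▸ V.mul_mem _ _ (SetLike.coe_mem _) (hzV 0 1 (by decide)))

open Filter in
theorem FlagSystem.finite_range {S : Type*} {x : S → Fin 4 → Fin 4 → ℝ} {k : S → ℝ}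
    (hx : ∀ s i j, i ≠ j → x s i j ≠ 0)
    (H : ∀ s, FlagSystem (fun i j => (x s i j)⁻¹)
      (fun i j l => x s i j / (x s i l * x s j l)) (k s))
    (hk : ∀ s, k s ≠ 0) (h01 : ∀ s, x s 0 1 = 1) {i j : Fin 4} (hij : i ≠ j) :
    (Set.range fun s => x s i j).Finite := by
  by_contra hinf
  have hne : (Filter.comap (fun s => x s i j) cofinite).NeBot := by
    rw [comap_neBot_iff]
    intro t ht
    by_contra! h
    exact hinf ((mem_cofinite.1 ht).subset (by rintro _ ⟨s, rfl⟩; exact h s))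
  let U := Ultrafilter.of (Filter.comap (fun s => x s i j) cofinite)
  let φ := Germ.coeRingHom (R := ℝ) (U : Filter S)
  let : Algebra ℝ (Germ (U : Filter S) ℝ) := (φ.comp (Pi.constRingHom S ℝ)).toAlgebra
  have hφ : ∀ f : S → ℝ, (∀ s, f s ≠ 0) → φ f ≠ 0 := fun f hf h0 => by
    obtain ⟨s, hs⟩ := (Germ.coe_eq.1 h0).exists
    exact hf s hs
  have HS : FlagSystem (fun i j => fun s => (x s i j)⁻¹)
      (fun i j l => fun s => x s i j / (x s i l * x s j l)) k :=
    { z_symm := fun i j => funext fun s => (H s).z_symm i j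
      u_symm := fun i j l => funext fun s => (H s).u_symm i j l
      u_mul_z := fun a b c d h => funext fun s => (H s).u_mul_z a b c d h
      u_mul_u := fun a b c d h => funext fun s => (H s).u_mul_u a b c d h
      u_path := fun a b c d h => funext fun s => (H s).u_path a b c d h
      edge := fun a b c d h => funext fun s => (H s).edge a b c d h }
  have halg : IsAlgebraic ℝ (φ fun s => x s i j) :=
    FlagSystem.isAlgebraic_of_normalized (x := fun i j => φ fun s => x s i j)
      (fun p q hpq => hφ _ fun s => hx s p q hpq) (HS.map φ) (hφ k hk)
      (congrArg φ (funext h01) : φ (fun s => x s 0 1) = φ 1) hij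
  obtain ⟨p, hp0, hp⟩ := halg
  have hcomp : Polynomial.aeval (φ fun s => x s i j) p = φ fun s => p.eval (x s i j) := by
    let ψ : (S → ℝ) →ₐ[ℝ] Germ (U : Filter S) ℝ := { φ with commutes' := fun _ => rfl }
    refine (Polynomial.aeval_algHom_apply ψ _ p).trans (congrArg φ (funext fun s => ?_))
    rw [Polynomial.aeval_fn_apply, Polynomial.coe_aeval_eq_eval]
  rw [hcomp] at hp
  have h1 : ∀ᶠ s in (U : Filter S), p.eval (x s i j) = 0 := Germ.coe_eq.1 hp
  have h2 : ∀ᶠ s in (U : Filter S), p.eval (x s i j) ≠ 0 := by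
    refine Ultrafilter.of_le _ (preimage_mem_comap (m := fun s => x s i j)
      (t := {y | p.eval y ≠ 0}) (mem_cofinite.2 ?_))
    refine (Polynomial.rootSet_finite p ℝ).subset fun y hy => ?_
    simpa [Polynomial.mem_rootSet, hp0] using hy
  obtain ⟨s, h3, h4⟩ := (h1.and h2).exists
  exact h4 h3

theorem symExt_symm (n : ℕ) (lam : FlagIdx n → ℝ) (i j : Fin (n + 1)) :
    symExt n lam i j = symExt n lam j i := by
  unfold symExt
  rcases lt_trichotomy i j with h | rfl | h
  · rw [dif_pos h, dif_neg h.asymm, dif_pos h]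
  · rfl
  · rw [dif_neg h.asymm, dif_pos h, dif_pos h]

theorem symExt_pos {n : ℕ} {lam : FlagIdx n → ℝ} (hpos : ∀ p, 0 < lam p) (i j : Fin (n + 1)) :
    0 < symExt n lam i j := by
  unfold symExt
  split_ifs
  · exact hpos _
  · exact hpos _
  · exact one_pos

theorem symExt_of_lt {n : ℕ} (lam : FlagIdx n → ℝ) {i j : Fin (n + 1)} (h : i < j) :
    symExt n lam i j = lam ⟨(i, j), h⟩ := dif_pos h

theorem ricci_symm (n : ℕ) (lam : FlagIdx n → ℝ) (i j : Fin (n + 1)) :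
    ricci n lam i j = ricci n lam j i := by
  unfold ricci
  rw [symExt_symm n lam i j]
  congr 2
  refine sum_congr (by ext; simp [and_comm]) fun l _ => ?_
  rw [symExt_symm n lam l j, symExt_symm n lam l i, symExt_symm n lam i l, symExt_symm n lam j l,
    mul_comm (symExt n lam l i)]
  ring

theorem IsEinstein.flagSystem {lam : FlagIdx 3 → ℝ} {k : ℝ} (hpos : ∀ p, 0 < lam p)
    (h : IsEinstein 3 lam k) :
    FlagSystem (fun i j => (symExt 3 lam i j)⁻¹)
      (fun i j l => symExt 3 lam i j / (symExt 3 lam i l * symExt 3 lam j l)) k := by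
  refine FlagSystem.of_inv (fun i j _ => (symExt_pos hpos i j).ne') (symExt_symm 3 lam) ?_
  intro a b c d hd
  have hr : ricci 3 lam a b = k := by
    rcases lt_or_gt_of_ne hd.1 with hab | hab
    · exact h a b hab
    · rw [ricci_symm]
      exact h b a hab
  have hf : univ.filter (fun l : Fin (3 + 1) => l ≠ a ∧ l ≠ b) = {c, d} := by
    ext l
    have := hd.eq_or l
    unfold Distinct4 at hd
    simp only [mem_filter, mem_univ, true_and, mem_insert, mem_singleton]
    grind
  rw [ricci, hf, sum_pair hd.2.2.2.2.2] at hr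
  rw [← hr, symExt_symm 3 lam c b, symExt_symm 3 lam d b, symExt_symm 3 lam b a,
    symExt_symm 3 lam c a, symExt_symm 3 lam d a]
  push_cast
  ring

theorem neg_inv_le_of_le {x y z : ℝ} (hy : 0 < y) (hz : 0 < z) (hyx : y ≤ x) (hzx : z ≤ x) :
    -x⁻¹ ≤ x / (y * z) - y / (x * z) - z / (x * y) := by
  have hx : 0 < x := hy.trans_le hyx
  have : x / (y * z) - y / (x * z) - z / (x * y) + x⁻¹ =
      (x ^ 2 - y ^ 2 - z ^ 2 + y * z) / (x * y * z) := by
    field_simp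
  have : 0 ≤ (x ^ 2 - y ^ 2 - z ^ 2 + y * z) / (x * y * z) := by
    refine div_nonneg ?_ (by positivity)
    rcases le_total y z with hyz | hyz <;> nlinarith
  linarith

theorem IsEinstein.ne_zero {lam : FlagIdx 3 → ℝ} {k : ℝ} (hpos : ∀ p, 0 < lam p)
    (h : IsEinstein 3 lam k) : k ≠ 0 := by
  rintro rfl
  obtain ⟨⟨⟨a, b⟩, hab⟩, -, hmax⟩ :=
    exists_max_image (univ : Finset {q : Fin 4 × Fin 4 // q.1 ≠ q.2})
      (fun q => symExt 3 lam q.1.1 q.1.2) ⟨⟨(0, 1), by decide⟩, mem_univ _⟩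
  obtain ⟨c, d, hd⟩ := exists_distinct4 hab
  have hm : ∀ p q, p ≠ q → symExt 3 lam p q ≤ symExt 3 lam a b := fun p q hpq =>
    hmax ⟨(p, q), hpq⟩ (mem_univ _)
  have e := (h.flagSystem hpos).edge a b c d hd
  have h1 := neg_inv_le_of_le (symExt_pos hpos a c) (symExt_pos hpos b c)
    (hm a c hd.2.1) (hm b c hd.2.2.2.1)
  have h2 := neg_inv_le_of_le (symExt_pos hpos a d) (symExt_pos hpos b d)
    (hm a d hd.2.2.1) (hm b d hd.2.2.2.2.1)
  have h3 := inv_pos.2 (symExt_pos hpos a b)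
  simp only [symExt_symm 3 lam c b, symExt_symm 3 lam d b, symExt_symm 3 lam b a,
    symExt_symm 3 lam c a, symExt_symm 3 lam d a] at e
  linarith

/-- For `n = 3` (the flag manifold `SU(4)/T³`), the set of
Einstein solutions of positive reals normalized by `λ₁₂ = 1` is finite: there
are only finitely many invariant Einstein metrics up to scaling. -/
theorem su4_finitely_many_einstein :
    {lam : FlagIdx 3 → ℝ | (∀ p, 0 < lam p) ∧ (∃ k : ℝ, IsEinstein 3 lam k) ∧
      lam ⟨(0, 1), by decide⟩ = 1}.Finite := by
  set Z := {lam : FlagIdx 3 → ℝ | (∀ p, 0 < lam p) ∧ (∃ k : ℝ, IsEinstein 3 lam k) ∧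
    lam ⟨(0, 1), by decide⟩ = 1}
  have hZ : ∀ s : Z, ∃ k, IsEinstein 3 s.1 k := fun s => s.2.2.1
  choose k hk using hZ
  refine (Set.Finite.pi fun p : FlagIdx 3 => FlagSystem.finite_range
    (x := fun s : Z => symExt 3 s.1) (k := k) (fun s i j _ => (symExt_pos s.2.1 i j).ne')
    (fun s => (hk s).flagSystem s.2.1) (fun s => (hk s).ne_zero s.2.1)
    (fun s => (symExt_of_lt s.1 (by decide)).trans s.2.2.2) p.2.ne).subset ?_
  intro lam hlam p _
  exact ⟨⟨lam, hlam⟩, symExt_of_lt lam p.2⟩
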